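/- Let Σ be a symmetric positive definite real 2n×2n matrix with symplectic eigenvalues λ₁,…,λ_n > 0 (i.e., the eigenvalues of JΣ are ±iλ₁,…,±iλ_n), and let η ∈ ℝ∖{0}. Then the Hermitian matrix Σ + (iη/2)J is positive semidefinite if and only if |η| ≤ 2λ_min, where λ_min = min(λ₁,…,λ_n). -/

import Mathlib

open scoped ComplexOrder

noncomputable section

/-- The standard symplectic matrix J = [[0, I], [−I, 0]] (real entries), with rows and
columns indexed by `Fin n ⊕ Fin n`. -/
def Jmat (n : ℕ) : Matrix (Fin n ⊕ Fin n) (Fin n ⊕ Fin n) ℝ :=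
  Matrix.fromBlocks 0 1 (-1) 0

namespace Matrix

variable {ι : Type*} [Fintype ι] [DecidableEq ι]

/-- For a Hermitian matrix `M` and real `t`, positivity of `M² + tM` is read off the spectrum. -/
lemma IsHermitian.posSemidef_mul_self_add_smul_iff {M : Matrix ι ι ℂ} (hM : M.IsHermitian)
    (t : ℝ) :
    (M * M + (t : ℂ) • M).PosSemidef ↔
      ∀ i, 0 ≤ hM.eigenvalues i * hM.eigenvalues i + t * hM.eigenvalues i := by
  set φ := Unitary.conjStarAlgAut ℂ (Matrix ι ι ℂ) hM.eigenvectorUnitary with hφ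
  set D : Matrix ι ι ℂ := diagonal (RCLike.ofReal ∘ hM.eigenvalues) with hD
  have hMD : M = φ D := hM.spectral_theorem
  have hsum : M * M + (t : ℂ) • M = φ (D * D + (t : ℂ) • D) := by
    rw [map_add, map_mul, map_smul, ← hMD]
  have hU : IsUnit (hM.eigenvectorUnitary : Matrix ι ι ℂ) :=
    (Unitary.toUnits hM.eigenvectorUnitary).isUnit
  have hdiag : D * D + (t : ℂ) • D = diagonal fun i =>
      ((hM.eigenvalues i * hM.eigenvalues i + t * hM.eigenvalues i : ℝ) : ℂ) := by
    rw [hD, diagonal_mul_diagonal, ← diagonal_smul, diagonal_add]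
    congr 1
    ext i
    simp
  rw [hsum, hφ, Unitary.conjStarAlgAut_apply]
  refine (IsUnit.posSemidef_star_right_conjugate_iff hU).trans ?_
  rw [hdiag, posSemidef_diagonal_iff]
  simp only [Complex.zero_le_real]

/-- A real number is an eigenvalue of a Hermitian matrix iff it is a root of its characteristic
polynomial. -/
lemma IsHermitian.exists_eigenvalues_eq_iff {M : Matrix ι ι ℂ} (hM : M.IsHermitian) (x : ℝ) :
    (∃ i, hM.eigenvalues i = x) ↔ M.charpoly.eval (x : ℂ) = 0 := by
  rw [hM.charpoly_eq, Polynomial.eval_prod, Finset.prod_eq_zero_iff]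
  simp only [Finset.mem_univ, true_and, Polynomial.eval_sub, Polynomial.eval_X,
    Polynomial.eval_C, sub_eq_zero]
  refine exists_congr fun i => ⟨fun h => by simp [h], fun h => ?_⟩
  exact (Complex.ofReal_injective h).symm

/-- Multiplying a complex matrix by `I` rotates the roots of its characteristic polynomial. -/
lemma eval_charpoly_I_smul_eq_zero_iff (A : Matrix ι ι ℂ) (z : ℂ) :
    (Complex.I • A).charpoly.eval z = 0 ↔ A.charpoly.eval (-Complex.I * z) = 0 := by
  have h : scalar ι z - Complex.I • A = Complex.I • (scalar ι (-Complex.I * z) - A) := by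
    have hz : z = Complex.I * (-Complex.I * z) := by linear_combination z * Complex.I_mul_I
    rw [smul_sub]
    congr 1
    conv_lhs => rw [hz]
    ext i j
    by_cases hij : i = j <;> simp [hij]
  rw [eval_charpoly, eval_charpoly, h, det_smul]
  simp

open scoped MatrixOrder in
/-- A positive definite matrix factors as `star B * B` with `B` invertible. -/
lemma PosDef.exists_isUnit_eq_star_mul_self {S : Matrix ι ι ℝ} (hS : S.PosDef) :
    ∃ B : Matrix ι ι ℝ, IsUnit B ∧ S = star B * B := by
  obtain ⟨B, hB⟩ := CStarAlgebra.nonneg_iff_eq_star_mul_self.mp hS.posSemidef.nonneg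
  refine ⟨B, ?_, hB⟩
  have h := hS.isUnit
  rw [hB] at h
  exact isUnit_of_mul_isUnit_right h

/-- If `P = star B * B` with `B` invertible and `K` is a Hermitian involution, then `P + tK` is
congruent to `M² + tM`, where `M = B K B*`. -/
lemma posSemidef_star_mul_self_add_smul_iff {B K : Matrix ι ι ℂ} (hB : IsUnit B)
    (hKs : star K = K) (hK : K * K = 1) (t : ℂ) :
    (star B * B + t • K).PosSemidef ↔
      ((B * K * star B) * (B * K * star B) + t • (B * K * star B)).PosSemidef := by
  have hV : IsUnit (B * K) := hB.mul (IsUnit.of_mul_eq_one K hK)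
  rw [← IsUnit.posSemidef_star_right_conjugate_iff hV, star_mul, hKs]
  have h : B * K * (star B * B + t • K) * (K * star B) =
      (B * K * star B) * (B * K * star B) + t • (B * K * star B) := by
    have h' : B * K * (t • K) * (K * star B) = t • (B * K * star B) := by
      rw [mul_smul_comm, smul_mul_assoc, mul_assoc B K K, hK, mul_one, mul_assoc]
    rw [mul_add, add_mul, h']
    simp only [mul_assoc]
  rw [h]

end Matrix

lemma Jmat_mul_self (n : ℕ) : Jmat n * Jmat n = -1 := by
  rw [Jmat, Matrix.fromBlocks_multiply, ← Matrix.fromBlocks_one, Matrix.fromBlocks_neg]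
  simp

lemma transpose_Jmat (n : ℕ) : (Jmat n).transpose = -Jmat n := by
  rw [Jmat, Matrix.fromBlocks_transpose, Matrix.fromBlocks_neg]
  simp

/-- For `0 < l`, `|t| ≤ l` is the condition for `x² + tx` to be nonnegative at both `x = l` and `x = -l`. -/
lemma forall_sq_eq_sq_nonneg_iff {l t : ℝ} (hl : 0 < l) :
    (∀ x : ℝ, x ^ 2 = l ^ 2 → 0 ≤ x * x + t * x) ↔ |t| ≤ l := by
  rw [abs_le]
  constructor
  · intro h
    have h₁ := h l rfl
    have h₂ := h (-l) (by ring)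
    constructor <;> nlinarith
  · rintro ⟨h₁, h₂⟩ x hx
    rcases sq_eq_sq_iff_eq_or_eq_neg.mp hx with rfl | rfl <;> nlinarith

/-- Let Σ be a symmetric positive definite real 2n×2n matrix with symplectic eigenvalues
λ₁,…,λ_n > 0 (the eigenvalues of JΣ being ±iλ_j, i.e. charpoly(JΣ) = Π_j (X² + λ_j²)),
and let η ≠ 0. Then the Hermitian matrix Σ + (iη/2)J is positive semidefinite iff
|η| ≤ 2 λ_min. -/
theorem gaussian_posSemidef_iff (n : ℕ) (hn : 0 < n) (η : ℝ) (hη : η ≠ 0)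
    (Sm : Matrix (Fin n ⊕ Fin n) (Fin n ⊕ Fin n) ℝ)
    (hSsymm : Sm.IsSymm) (hS : Sm.PosDef)
    (lam : Fin n → ℝ) (hlam : ∀ j, 0 < lam j)
    (hchar : (Jmat n * Sm).charpoly
      = ∏ j : Fin n, (Polynomial.X ^ 2 + Polynomial.C ((lam j) ^ 2))) :
    (Sm.map (Complex.ofReal ·) + (Complex.I * (η : ℂ) / 2) •
        (Jmat n).map (Complex.ofReal ·)).PosSemidef
    ↔ |η| ≤ 2 * Finset.univ.inf' ⟨(⟨0, hn⟩ : Fin n), Finset.mem_univ _⟩ lam := by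
  set f : Matrix (Fin n ⊕ Fin n) (Fin n ⊕ Fin n) ℝ →+* Matrix (Fin n ⊕ Fin n) (Fin n ⊕ Fin n) ℂ :=
    Complex.ofRealHom.mapMatrix with hf
  have hstar : ∀ A, star (f A) = f A.transpose := by
    intro A
    ext i j
    simp [hf, Matrix.star_apply]
  obtain ⟨B, hBu, hB⟩ := hS.exists_isUnit_eq_star_mul_self
  have hBS : f Sm = star (f B) * f B := by
    rw [hB, map_mul, hstar, Matrix.star_eq_conjTranspose,
      Matrix.conjTranspose_eq_transpose_of_trivial]
  set K := Complex.I • f (Jmat n) with hKdef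
  have hKs : star K = K := by
    rw [hKdef, star_smul, hstar, transpose_Jmat, map_neg]
    simp
  have hK : K * K = 1 := by
    rw [hKdef, smul_mul_smul_comm, ← map_mul, Jmat_mul_self, Complex.I_mul_I, map_neg, map_one]
    simp
  have hlhs : Sm.map (Complex.ofReal ·) + (Complex.I * (η : ℂ) / 2) •
      (Jmat n).map (Complex.ofReal ·) = star (f B) * f B + ((η / 2 : ℝ) : ℂ) • K := by
    rw [← hBS, hKdef, smul_smul]
    have hc : ((η / 2 : ℝ) : ℂ) * Complex.I = Complex.I * (η : ℂ) / 2 := by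
      push_cast
      ring
    rw [hc]
    rfl
  have hM : (f B * K * star (f B)).IsHermitian := by
    change star _ = _
    simp only [star_mul, star_star, hKs, mul_assoc]
  have hcharM : (f B * K * star (f B)).charpoly = (Complex.I • f (Jmat n * Sm)).charpoly := by
    rw [mul_assoc, Matrix.charpoly_mul_comm, mul_assoc, ← hBS, hKdef, smul_mul_assoc, map_mul]
  have heig : ∀ x : ℝ, (∃ i, hM.eigenvalues i = x) ↔ ∃ j, x ^ 2 = lam j ^ 2 := by
    intro x
    have hchar' : (f (Jmat n * Sm)).charpoly =
        (∏ j : Fin n, (Polynomial.X ^ 2 + Polynomial.C ((lam j) ^ 2))).map Complex.ofRealHom := by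
      rw [← hchar, ← Matrix.charpoly_map]
      rfl
    rw [hM.exists_eigenvalues_eq_iff, hcharM, Matrix.eval_charpoly_I_smul_eq_zero_iff, hchar',
      Polynomial.map_prod, Polynomial.eval_prod, Finset.prod_eq_zero_iff]
    simp only [Finset.mem_univ, true_and]
    refine exists_congr fun j => ?_
    have he : ((Polynomial.X ^ 2 + Polynomial.C ((lam j) ^ 2)).map Complex.ofRealHom).eval
        (-Complex.I * (x : ℂ)) = ((lam j ^ 2 - x ^ 2 : ℝ) : ℂ) := by
      simp [mul_pow]
      ring
    rw [he, Complex.ofReal_eq_zero, sub_eq_zero, eq_comm]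
  rw [hlhs, Matrix.posSemidef_star_mul_self_add_smul_iff (hBu.map f) hKs hK,
    hM.posSemidef_mul_self_add_smul_iff]
  have hinf : |η| ≤ 2 * Finset.univ.inf' ⟨(⟨0, hn⟩ : Fin n), Finset.mem_univ _⟩ lam ↔
      ∀ j, |η / 2| ≤ lam j := by
    rw [abs_div, abs_two, ← div_le_iff₀' two_pos]
    exact (Finset.le_inf'_iff _ _).trans (by simp)
  rw [hinf]
  simp only [← forall_sq_eq_sq_nonneg_iff (hlam _)]
  constructor
  · intro h j x hx
    obtain ⟨i, rfl⟩ := (heig x).mpr ⟨j, hx⟩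
    exact h i
  · intro h i
    obtain ⟨j, hj⟩ := (heig _).mp ⟨i, rfl⟩
    exact h j _ hj
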